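/- Let K be a field and let a : ℤ → K be a sequence with a_i ≠ 0 for all i ∈ ℤ. Then there exists a unique tame SL_2-tiling A : ℤ × ℤ → K such that A(i, i) = a_i and A(i, i+1) = 1 for all i ∈ ℤ. -/

import Mathlib

/-- The adjacent `m × m` minor of a tiling `A : ℤ × ℤ → K` at position `(i, j)`. -/
noncomputable def adjMinor {K : Type*} [Field K] (A : ℤ × ℤ → K) (m : ℕ) (i j : ℤ) : K :=
  (Matrix.of fun s t : Fin m => A (i + ((s : ℕ) : ℤ), j + ((t : ℕ) : ℤ))).det

/-- `A` is an `SL_k`-tiling: all adjacent `k × k` minors equal `1`. -/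
def IsSL {K : Type*} [Field K] (k : ℕ) (A : ℤ × ℤ → K) : Prop :=
  ∀ i j : ℤ, adjMinor A k i j = 1

/-- The rank of a tiling: the dimension of the `K`-linear span of its rows. -/
noncomputable def tilingRank (K : Type*) [Field K] (A : ℤ × ℤ → K) : Cardinal :=
  Module.rank K (Submodule.span K (Set.range fun i : ℤ => fun j : ℤ => A (i, j)))

/-- A bi-infinite orbit of a sequence of bijections exists through any given point. -/
theorem exists_int_orbit {X : Type*} (e : ℤ → X ≃ X) (x₀ : X) :
    ∃ x : ℤ → X, x 0 = x₀ ∧ ∀ i, x (i + 1) = e i (x i) := by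
  let p : ℕ → X := fun n => Nat.rec x₀ (fun n y => e n y) n
  let q : ℕ → X := fun n => Nat.rec x₀ (fun n y => (e (-(n : ℤ) - 1)).symm y) n
  refine ⟨fun i => if 0 ≤ i then p i.toNat else q (-i).toNat, by simp [p], fun i => ?_⟩
  dsimp only
  rcases lt_or_ge i 0 with h | h
  · obtain ⟨n, rfl⟩ : ∃ n : ℕ, i = -(n : ℤ) - 1 := ⟨(-i - 1).toNat, by omega⟩
    have hq : q (n + 1) = (e (-(n : ℤ) - 1)).symm (q n) := rfl
    have h1 : (-(-(n : ℤ) - 1)).toNat = n + 1 := by omega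
    rw [if_neg h.not_ge, h1, hq, Equiv.apply_symm_apply]
    rcases n with _ | n
    · simp [p, q]
    · rw [if_neg (by omega)]
      congr 1
  · lift i to ℕ using h
    have h1 : ((i : ℤ) + 1).toNat = i + 1 := by omega
    rw [if_pos (by omega), if_pos (by omega), h1]
    rfl

/-- Existence of bi-infinite solutions of `x (i + 2) = b i * x (i + 1) - x i`. -/
theorem exists_recurrence_solution {K : Type*} [Field K] (b : ℤ → K) (x₀ x₁ : K) :
    ∃ x : ℤ → K, x 0 = x₀ ∧ x 1 = x₁ ∧ ∀ i, x (i + 2) = b i * x (i + 1) - x i := by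
  obtain ⟨z, hz₀, hz⟩ := exists_int_orbit
    (fun i => (⟨fun y => (y.2, b i * y.2 - y.1), fun y => (b i * y.1 - y.2, y.1),
      fun y => by simp, fun y => by simp⟩ : K × K ≃ K × K)) (x₀, x₁)
  have hfst : ∀ i, (z (i + 1)).1 = (z i).2 := fun i => by rw [hz]; rfl
  refine ⟨fun i => (z i).1, by simp [hz₀], ?_, fun i => ?_⟩
  · simpa [hz₀] using hfst 0
  · have h2 : (z (i + 1 + 1)).1 = b i * (z i).2 - (z i).1 := by rw [hfst, hz]; rfl
    simpa [hfst, add_assoc] using h2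

/-- A solution of `x (i + 2) = b i * x (i + 1) - x i` is determined by two adjacent values. -/
theorem recurrence_solution_unique {K : Type*} [Field K] {b x y : ℤ → K}
    (hx : ∀ i, x (i + 2) = b i * x (i + 1) - x i) (hy : ∀ i, y (i + 2) = b i * y (i + 1) - y i)
    (j : ℤ) (h₀ : x j = y j) (h₁ : x (j + 1) = y (j + 1)) (i : ℤ) : x i = y i := by
  suffices x i = y i ∧ x (i + 1) = y (i + 1) from this.1
  induction i using Int.inductionOn' (b := j) with
  | zero => exact ⟨h₀, h₁⟩
  | succ k _ ih =>
    refine ⟨ih.2, ?_⟩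
    rw [add_assoc, one_add_one_eq_two, hx, hy, ih.1, ih.2]
  | pred k _ ih =>
    have h1 := hx (k - 1)
    have h2 := hy (k - 1)
    rw [show k - 1 + 2 = k + 1 by ring, sub_add_cancel] at h1 h2
    rw [sub_add_cancel]
    refine ⟨?_, ih.1⟩
    linear_combination h1 - h2 - ih.2 + b (k - 1) * ih.1

/-- The Wronskian of two solutions of `x (i + 2) = b i * x (i + 1) - x i` is constant. -/
theorem recurrence_wronskian {K : Type*} [Field K] {b u w : ℤ → K}
    (hu : ∀ i, u (i + 2) = b i * u (i + 1) - u i) (hw : ∀ i, w (i + 2) = b i * w (i + 1) - w i)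
    (i : ℤ) : u i * w (i + 1) - u (i + 1) * w i = u 0 * w 1 - u 1 * w 0 := by
  have step : ∀ k, u (k + 1) * w (k + 2) - u (k + 2) * w (k + 1)
      = u k * w (k + 1) - u (k + 1) * w k := fun k => by rw [hu, hw]; ring
  induction i using Int.induction_on with
  | zero => simp
  | succ k ih => rw [← ih, ← step k, add_assoc (k : ℤ), one_add_one_eq_two]
  | pred k ih =>
    rw [← ih, ← step, show -(k : ℤ) - 1 + 2 = -(k : ℤ) + 1 by ring, sub_add_cancel]

theorem isSL_two_iff {K : Type*} [Field K] {A : ℤ × ℤ → K} :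
    IsSL 2 A ↔ ∀ i j, A (i, j) * A (i + 1, j + 1) - A (i, j + 1) * A (i + 1, j) = 1 := by
  simp [IsSL, adjMinor, Matrix.det_fin_two]

/-- Adjacent rows of an `SL₂`-tiling are linearly independent. -/
theorem IsSL.linearIndependent_rows {K : Type*} [Field K] {A : ℤ × ℤ → K} (hA : IsSL 2 A)
    (i : ℤ) : LinearIndependent K ![fun j : ℤ => A (i, j), fun j : ℤ => A (i + 1, j)] := by
  rw [LinearIndependent.pair_iff]
  intro s t h
  have h0 := congrFun h 0
  have h1 := congrFun h 1
  have hd := isSL_two_iff.1 hA i 0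
  simp only [Pi.add_apply, Pi.smul_apply, smul_eq_mul, Pi.zero_apply, zero_add] at h0 h1 hd
  constructor
  · linear_combination (-s) * hd + A (i + 1, 1) * h0 - A (i + 1, 0) * h1
  · linear_combination (-t) * hd + A (i, 0) * h1 - A (i, 1) * h0

/-- In a tame `SL₂`-tiling, every row is a combination of any two adjacent rows. -/
theorem IsSL.exists_row_eq {K : Type*} [Field K] {A : ℤ × ℤ → K} (hA : IsSL 2 A)
    (hr : tilingRank K A = 2) (i k : ℤ) :
    ∃ α β : K, ∀ j, A (k, j) = α * A (i, j) + β * A (i + 1, j) := by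
  set S := Submodule.span K (Set.range fun i : ℤ => fun j : ℤ => A (i, j)) with hS
  have hfin : Module.finrank K S = 2 := Module.finrank_eq_of_rank_eq (n := 2) hr
  have : FiniteDimensional K S := Module.finite_of_finrank_pos (by omega)
  have hmem : ∀ k, (fun j : ℤ => A (k, j)) ∈ S := fun k => Submodule.subset_span ⟨k, rfl⟩
  have hle : Submodule.span K {(fun j : ℤ => A (i, j)), fun j : ℤ => A (i + 1, j)} ≤ S := by
    rw [Submodule.span_le]
    rintro _ (rfl | rfl) <;> exact hmem _
  have hspan : Submodule.span K {(fun j : ℤ => A (i, j)), fun j : ℤ => A (i + 1, j)} = S := by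
    refine Submodule.eq_of_le_of_finrank_eq hle ?_
    have := finrank_span_eq_card (hA.linearIndependent_rows i)
    rw [Matrix.range_cons, Matrix.range_cons, Matrix.range_empty, Set.union_empty,
      Set.singleton_union] at this
    rw [hfin, this, Fintype.card_fin]
  have hk := hmem k
  rw [← hspan, Submodule.mem_span_pair] at hk
  obtain ⟨α, β, h⟩ := hk
  exact ⟨α, β, fun j => by simpa using (congrFun h j).symm⟩

/-- An `SL₂`-tiling whose rows lie in the span of two functions is tame. -/
theorem IsSL.tilingRank_eq_two {K : Type*} [Field K] {A : ℤ × ℤ → K} (hA : IsSL 2 A)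
    {f g : ℤ → K} (h : ∀ i, (fun j : ℤ => A (i, j)) ∈ Submodule.span K {f, g}) :
    tilingRank K A = 2 := by
  classical
  apply le_antisymm
  · refine (Submodule.rank_mono (Submodule.span_le.2 ?_)).trans
      ((rank_span_le ({f, g} : Set (ℤ → K))).trans ?_)
    · rintro _ ⟨i, rfl⟩
      exact h i
    · refine (Cardinal.mk_insert_le).trans ?_
      rw [Cardinal.mk_singleton, one_add_one_eq_two]
  · have hfin := finrank_span_eq_card (hA.linearIndependent_rows 0)
    have : FiniteDimensional K (Submodule.span K
        (Set.range ![fun j : ℤ => A (0, j), fun j : ℤ => A (0 + 1, j)])) :=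
      FiniteDimensional.span_of_finite K (Set.finite_range _)
    have hle := Submodule.rank_mono (R := K) (Submodule.span_mono (R := K) (show
      Set.range ![fun j : ℤ => A (0, j), fun j : ℤ => A (0 + 1, j)] ⊆
        Set.range fun i : ℤ => fun j : ℤ => A (i, j) by
      rintro _ ⟨s, rfl⟩
      fin_cases s
      exacts [⟨0, rfl⟩, ⟨0 + 1, rfl⟩]))
    rw [← Module.finrank_eq_rank, hfin, Fintype.card_fin] at hle
    exact_mod_cast hle

/-- The row recurrence of a tame `SL₂`-tiling with ones on the diagonal above the main one. -/
theorem IsSL.row_recurrence {K : Type*} [Field K] {A : ℤ × ℤ → K} (hA : IsSL 2 A)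
    (hr : tilingRank K A = 2) (h0 : ∀ i, A (i, i) ≠ 0) (h1 : ∀ i, A (i, i + 1) = 1) (i j : ℤ) :
    A (i + 2, j) = A (i + 2, i + 2) * A (i + 1, j) - A (i, j) := by
  obtain ⟨α, β, h⟩ := hA.exists_row_eq hr i (i + 2)
  have m0 := isSL_two_iff.1 hA i (i + 1)
  have m1 := isSL_two_iff.1 hA (i + 1) (i + 1)
  have e1 := h (i + 1)
  have e2 := h (i + 2)
  have d1 := h1 (i + 1)
  simp only [add_assoc, one_add_one_eq_two] at m0 m1 d1
  have hα : α = -1 := by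
    linear_combination (-α) * m0 - m1 - A (i + 1, i + 2) * e1 + A (i + 1, i + 1) * e2
  have hβ : β = A (i + 2, i + 2) := by
    apply mul_right_cancel₀ (h0 (i + 1))
    rw [d1] at m1
    linear_combination -m1 - e1 - A (i, i + 1) * hα + h1 i
  rw [h, hα, hβ]
  ring

/-- Given a bi-infinite sequence of nonzero scalars `a_i`, there is a unique tame
`SL₂`-tiling with `A (i, i) = a i` on the main diagonal and `A (i, i+1) = 1` on
the diagonal just above it. -/
theorem existsUnique_tame_SL2_extension {K : Type*} [Field K]
    (a : ℤ → K) (ha : ∀ i : ℤ, a i ≠ 0) :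
    ∃! A : ℤ × ℤ → K,
      IsSL 2 A ∧ tilingRank K A = 2 ∧
        (∀ i : ℤ, A (i, i) = a i) ∧ (∀ i : ℤ, A (i, i + 1) = 1) := by
  apply existsUnique_of_exists_of_unique
  · obtain ⟨u, hu0, hu1, hu⟩ := exists_recurrence_solution (fun i => a (i + 2)) 1 0
    obtain ⟨w, hw0, hw1, hw⟩ := exists_recurrence_solution (fun i => a (i + 2)) 0 1
    have hW : ∀ i, u i * w (i + 1) - u (i + 1) * w i = 1 := fun i => by
      rw [recurrence_wronskian hu hw, hu0, hu1, hw0, hw1]; ring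
    let A : ℤ × ℤ → K := fun p => u (p.2 - 2) * w p.1 - u p.1 * w (p.2 - 2)
    have hA : IsSL 2 A := by
      refine isSL_two_iff.2 fun i j => ?_
      have h1 := hW i
      have h2 := hW (j - 2)
      simp only [A, show j + 1 - 2 = j - 2 + 1 by ring]
      linear_combination (u (j - 2) * w (j - 2 + 1) - u (j - 2 + 1) * w (j - 2)) * h1 + h2
    refine ⟨A, hA, hA.tilingRank_eq_two (f := fun j => u (j - 2)) (g := fun j => w (j - 2))
      fun i => Submodule.mem_span_pair.2 ⟨w i, -u i, ?_⟩, fun i => ?_, fun i => ?_⟩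
    · ext j
      simp only [A, Pi.add_apply, Pi.smul_apply, smul_eq_mul]
      ring
    · have h1 := hu (i - 2)
      have h2 := hw (i - 2)
      have h3 := hW (i - 2)
      simp only [sub_add_cancel] at h1 h2
      simp only [A]
      rw [h1, h2]
      linear_combination a i * h3
    · have h3 := hW (i - 1)
      rw [sub_add_cancel] at h3
      simp only [A, show i + 1 - 2 = i - 1 by ring]
      linear_combination h3
  · rintro A B ⟨hA, hAr, hA0, hA1⟩ ⟨hB, hBr, hB0, hB1⟩
    ext ⟨i, j⟩
    have recA : ∀ i, A (i + 2, j) = a (i + 2) * A (i + 1, j) - A (i, j) := fun i => by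
      rw [hA.row_recurrence hAr (fun i => by rw [hA0]; exact ha i) hA1, hA0]
    have recB : ∀ i, B (i + 2, j) = a (i + 2) * B (i + 1, j) - B (i, j) := fun i => by
      rw [hB.row_recurrence hBr (fun i => by rw [hB0]; exact ha i) hB1, hB0]
    refine recurrence_solution_unique (b := fun i => a (i + 2)) (x := fun i => A (i, j))
      (y := fun i => B (i, j)) recA recB (j - 1) ?_ ?_ i
    · have h1 := hA1 (j - 1)
      have h2 := hB1 (j - 1)
      rw [sub_add_cancel] at h1 h2
      exact h1.trans h2.symm
    · simp only [sub_add_cancel, hA0, hB0]
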